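/- (Linear-algebra core of Theorem 5, stability preservation at stationary solutions of nonlinear systems.) Let E ∈ ℝ^{n×n} be invertible and J ∈ ℝ^{n×n} (the Jacobian matrix of the right-hand side f at the stationary solution x* = 0). Let M ∈ ℝ^{n×n} be symmetric positive definite and satisfy the Lyapunov equation Jᵀ M E + Eᵀ M J + F = 0 for some symmetric positive definite F ∈ ℝ^{n×n}. Let V ∈ ℝ^{n×r} have full column rank. Then Ē = Vᵀ Eᵀ M E V is symmetric positive definite, and the reduced Jacobian matrix Ē⁻¹ (Vᵀ Eᵀ M J V) is a stable matrix, i.e. all its eigenvalues have strictly negative real part. Consequently, the stationary solution x̄* = 0 of the reduced nonlinear system is asymptotically stable. -/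

import Mathlib

open Matrix

namespace Matrix

/-- A matrix whose rank is its number of columns acts injectively on vectors. -/
theorem mulVec_injective_of_rank_eq_card {m n K : Type*} [Fintype m] [Fintype n] [Field K]
    {V : Matrix m n K} (hV : V.rank = Fintype.card n) : Function.Injective V.mulVec := by
  rw [mulVec_injective_iff, linearIndependent_iff_card_eq_finrank_span, ← hV,
    rank_eq_finrank_span_cols, Set.finrank]

/-- A complex eigenvalue of a real matrix acts on the real and imaginary parts of an
eigenvector as a rotation-scaling. -/
theorem exists_mulVec_eq_of_mem_spectrum_map {m : Type*} [Fintype m] [DecidableEq m]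
    {A : Matrix m m ℝ} {μ : ℂ} (hμ : μ ∈ spectrum ℂ (A.map (algebraMap ℝ ℂ))) :
    ∃ x y : m → ℝ, (x ≠ 0 ∨ y ≠ 0) ∧ A *ᵥ x = μ.re • x - μ.im • y ∧
      A *ᵥ y = μ.im • x + μ.re • y := by
  rw [spectrum.mem_iff, isUnit_iff_isUnit_det, isUnit_iff_ne_zero, not_not,
    ← exists_mulVec_eq_zero_iff] at hμ
  obtain ⟨v, hv, h⟩ := hμ
  rw [sub_mulVec, sub_eq_zero, Algebra.algebraMap_eq_smul_one, smul_mulVec, one_mulVec] at h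
  refine ⟨fun i => (v i).re, fun i => (v i).im, ?_, ?_, ?_⟩
  · by_contra! hxy
    exact hv (funext fun i => Complex.ext (congrFun hxy.1 i) (congrFun hxy.2 i))
  · ext i
    simpa [mulVec, dotProduct] using (congrArg Complex.re (congrFun h i)).symm
  · ext i
    simpa [mulVec, dotProduct, add_comm] using (congrArg Complex.im (congrFun h i)).symm

/-- If `P` is positive definite and the symmetric part of `K` is negative definite, then
`P⁻¹ * K` is a stable matrix. -/
theorem PosDef.re_neg_of_mem_spectrum_inv_mul {m : Type*} [Fintype m] [DecidableEq m]
    {P K : Matrix m m ℝ} (hP : P.PosDef) (hK : (-(K + Kᵀ)).PosDef) {μ : ℂ}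
    (hμ : μ ∈ spectrum ℂ ((P⁻¹ * K).map (algebraMap ℝ ℂ))) : μ.re < 0 := by
  obtain ⟨x, y, hxy, hx, hy⟩ := exists_mulVec_eq_of_mem_spectrum_map hμ
  have hPK : P * (P⁻¹ * K) = K := mul_nonsing_inv_cancel_left P K hP.det_pos.ne'.isUnit
  have hKx : x ⬝ᵥ K *ᵥ x = μ.re * (x ⬝ᵥ P *ᵥ x) - μ.im * (x ⬝ᵥ P *ᵥ y) := by
    rw [← hPK, ← mulVec_mulVec, hx]
    simp [mulVec_sub, mulVec_smul, dotProduct_sub]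
  have hKy : y ⬝ᵥ K *ᵥ y = μ.im * (y ⬝ᵥ P *ᵥ x) + μ.re * (y ⬝ᵥ P *ᵥ y) := by
    rw [← hPK, ← mulVec_mulVec, hy]
    simp [mulVec_add, mulVec_smul, dotProduct_add]
  have hsymm : y ⬝ᵥ P *ᵥ x = x ⬝ᵥ P *ᵥ y := by
    rw [← dotProduct_transpose_mulVec, ← conjTranspose_eq_transpose_of_trivial, hP.isHermitian.eq]
  have hform (z : m → ℝ) : z ⬝ᵥ (-(K + Kᵀ)) *ᵥ z = -2 * (z ⬝ᵥ K *ᵥ z) := by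
    rw [neg_mulVec, add_mulVec, dotProduct_neg, dotProduct_add, dotProduct_transpose_mulVec]
    ring
  have hPnonneg (z : m → ℝ) : 0 ≤ z ⬝ᵥ P *ᵥ z := hP.posSemidef.dotProduct_mulVec_nonneg z
  have hKnonpos (z : m → ℝ) : z ⬝ᵥ K *ᵥ z ≤ 0 := by
    have := hK.posSemidef.dotProduct_mulVec_nonneg z
    rw [star_trivial, hform] at this
    linarith
  have hKneg {z : m → ℝ} (hz : z ≠ 0) : z ⬝ᵥ K *ᵥ z < 0 := by
    have := hK.dotProduct_mulVec_pos hz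
    rw [star_trivial, hform] at this
    linarith
  have hsum : x ⬝ᵥ K *ᵥ x + y ⬝ᵥ K *ᵥ y < 0 := by
    rcases hxy with h | h
    · linarith [hKneg h, hKnonpos y]
    · linarith [hKneg h, hKnonpos x]
  have hmul : μ.re * (x ⬝ᵥ P *ᵥ x + y ⬝ᵥ P *ᵥ y) < 0 := by
    rw [hKx, hKy, hsymm] at hsum
    linarith
  exact neg_of_mul_neg_left hmul (add_nonneg (hPnonneg x) (hPnonneg y))

end Matrix

/-- Linear-algebra core of Theorem 5 (stability preservation at stationary
solutions of nonlinear systems). Let `E` be invertible, `J` the Jacobian of the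
right-hand side at the stationary solution, and `M` symmetric positive definite
satisfying the Lyapunov equation `Jᵀ M E + Eᵀ M J + F = 0` for some symmetric
positive definite `F`. Let `V` have full column rank. Then `Ē = Vᵀ Eᵀ M E V` is
symmetric positive definite and the reduced Jacobian `Ē⁻¹ (Vᵀ Eᵀ M J V)` is a
stable matrix (all complex eigenvalues with negative real part), so the reduced
stationary solution is asymptotically stable. -/
theorem reduced_jacobian_stable {n r : ℕ}
    (E J M F : Matrix (Fin n) (Fin n) ℝ) (V : Matrix (Fin n) (Fin r) ℝ)
    (hE : IsUnit E.det) (hM : M.PosDef) (hF : F.PosDef)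
    (hlyap : Jᵀ * M * E + Eᵀ * M * J + F = 0) (hV : V.rank = r) :
    (Vᵀ * Eᵀ * M * E * V).PosDef ∧
      ∀ μ ∈ spectrum ℂ
        (((Vᵀ * Eᵀ * M * E * V)⁻¹ * (Vᵀ * Eᵀ * M * J * V)).map (algebraMap ℝ ℂ)),
        μ.re < 0 := by
  have hVinj : Function.Injective V.mulVec := mulVec_injective_of_rank_eq_card (by simpa using hV)
  have hEV : Function.Injective (E * V).mulVec := fun x y h => by
    rw [← mulVec_mulVec, ← mulVec_mulVec] at h
    exact hVinj (mulVec_injective_of_det_ne_zero hE.ne_zero h)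
  have hP : (Vᵀ * Eᵀ * M * E * V).PosDef := by
    simpa [conjTranspose_eq_transpose_of_trivial, transpose_mul, Matrix.mul_assoc] using
      hM.conjTranspose_mul_mul_same hEV
  refine ⟨hP, fun μ hμ => hP.re_neg_of_mem_spectrum_inv_mul ?_ hμ⟩
  have hMsymm : Mᵀ = M := by
    rw [← conjTranspose_eq_transpose_of_trivial, hM.isHermitian.eq]
  have hFeq : F = -(Eᵀ * M * J + Jᵀ * M * E) := by
    rw [eq_neg_iff_add_eq_zero, ← hlyap]
    abel
  have hVFV : -(Vᵀ * Eᵀ * M * J * V + (Vᵀ * Eᵀ * M * J * V)ᵀ) = Vᵀ * F * V := by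
    simp only [hFeq, transpose_mul, transpose_transpose, hMsymm, Matrix.mul_neg, Matrix.neg_mul,
      Matrix.mul_add, Matrix.add_mul, Matrix.mul_assoc]
  rw [hVFV, ← conjTranspose_eq_transpose_of_trivial]
  exact hF.conjTranspose_mul_mul_same hVinj
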